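/- Let α ∈ (0,1] and γ ∈ ℝ. Let Φ : (0,∞) → ℝ be three times continuously differentiable and satisfy the conformable fractional second Painlevé equation D^{2α}Φ(ω) = 2Φ(ω)³ + (ω^α/α)·Φ(ω) + γ for all ω > 0. Define W(ω) = −D^αΦ(ω) − Φ(ω)². Then at every ω > 0 with 2W(ω) ≠ ω^α/α, W satisfies D^{2α}W(ω) + 2W(ω)² − (ω^α/α)·W(ω) + [γ(γ+1) + D^αW(ω) − (D^αW(ω))²]/(2W(ω) − ω^α/α) = 0. -/

import Mathlib

open Filter Set MeasureTheory

/-- `f` is α-differentiable at `t` with conformable fractional derivative `L`: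
`D^α f(t) = lim_{ε→0} (f(t + ε t^{1-α}) - f t)/ε = L`. -/
def HasConfDerivAt (α : ℝ) (f : ℝ → ℝ) (L t : ℝ) : Prop :=
  Filter.Tendsto (fun ε : ℝ => (f (t + ε * t ^ (1 - α)) - f t) / ε)
    (nhdsWithin 0 {(0 : ℝ)}ᶜ) (nhds L)

/-- The conformable fractional derivative operator `D^α` (junk value if the limit
does not exist). -/
noncomputable def confDeriv (α : ℝ) (f : ℝ → ℝ) (t : ℝ) : ℝ :=
  limUnder (nhdsWithin 0 {(0 : ℝ)}ᶜ)
    (fun ε : ℝ => (f (t + ε * t ^ (1 - α)) - f t) / ε)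

theorem HasDerivAt.hasConfDerivAt {α t f' : ℝ} {f : ℝ → ℝ}
    (hf : HasDerivAt f f' t) : HasConfDerivAt α f (t ^ (1 - α) * f') t := by
  have hline : HasDerivAt (fun ε : ℝ => t + ε * t ^ (1 - α)) (t ^ (1 - α)) 0 := by
    simpa using ((hasDerivAt_id (0 : ℝ)).mul_const (t ^ (1 - α))).const_add t
  have hcomp : HasDerivAt (fun ε : ℝ => f (t + ε * t ^ (1 - α))) (f' * t ^ (1 - α)) 0 :=
    HasDerivAt.comp (h₂ := f) 0 (by simpa using hf) hline
  have hslope := hasDerivAt_iff_tendsto_slope_zero.mp hcomp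
  rw [HasConfDerivAt, mul_comm]
  refine hslope.congr fun ε => ?_
  simp [div_eq_inv_mul]

theorem HasDerivAt.confDeriv_eq {α t f' : ℝ} {f : ℝ → ℝ}
    (hf : HasDerivAt f f' t) : confDeriv α f t = t ^ (1 - α) * f' :=
  hf.hasConfDerivAt.limUnder_eq

theorem DifferentiableAt.hasDerivAt_confDeriv {α t : ℝ} {f : ℝ → ℝ} (ht : 0 < t)
    (hf : DifferentiableAt ℝ f t) : HasDerivAt f (confDeriv α f t / t ^ (1 - α)) t := by
  have hc : t ^ (1 - α) ≠ 0 := (Real.rpow_pos_of_pos ht _).ne'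
  rw [hf.hasDerivAt.confDeriv_eq, mul_div_cancel_left₀ _ hc]
  exact hf.hasDerivAt

theorem hasDerivAt_rpow_div_self {α t : ℝ} (hα : α ≠ 0) (ht : 0 < t) :
    HasDerivAt (fun x : ℝ => x ^ α / α) (1 / t ^ (1 - α)) t := by
  refine ((Real.hasDerivAt_rpow_const (p := α) (Or.inl ht.ne')).div_const α).congr_deriv ?_
  rw [mul_div_cancel_left₀ _ hα, ← neg_sub, Real.rpow_neg ht.le, one_div]

theorem ContDiffOn.differentiableAt_confDeriv {α t : ℝ} {f : ℝ → ℝ} (ht : 0 < t)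
    (hf : ContDiffOn ℝ 2 f (Set.Ioi 0)) : DifferentiableAt ℝ (confDeriv α f) t := by
  have hderiv : DifferentiableAt ℝ (deriv f) t :=
    ((hf.deriv_of_isOpen (m := 1) isOpen_Ioi (by norm_num)).differentiableOn
      one_ne_zero).differentiableAt (Ioi_mem_nhds ht)
  have hpow : DifferentiableAt ℝ (fun x : ℝ => x ^ (1 - α)) t :=
    (Real.hasDerivAt_rpow_const (Or.inl ht.ne')).differentiableAt
  refine (hpow.mul hderiv).congr_of_eventuallyEq ?_
  filter_upwards [Ioi_mem_nhds ht] with x hx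
  exact ((hf.differentiableOn two_ne_zero).differentiableAt
    (Ioi_mem_nhds hx)).hasDerivAt.confDeriv_eq

theorem painleveII_to_K2 (α γ : ℝ) (hα : 0 < α ∧ α ≤ 1)
    (Φ : ℝ → ℝ) (hΦ : ContDiffOn ℝ 3 Φ (Set.Ioi 0))
    (hP2 : ∀ ω > (0 : ℝ),
      confDeriv α (confDeriv α Φ) ω = 2 * (Φ ω) ^ 3 + (ω ^ α / α) * Φ ω + γ)
    (W : ℝ → ℝ) (hWdef : ∀ ω : ℝ, W ω = -(confDeriv α Φ ω) - (Φ ω) ^ 2) :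
    ∀ ω > (0 : ℝ), 2 * W ω ≠ ω ^ α / α →
      confDeriv α (confDeriv α W) ω + 2 * (W ω) ^ 2 - (ω ^ α / α) * W ω
        + (γ * (γ + 1) + confDeriv α W ω - (confDeriv α W ω) ^ 2)
            / (2 * W ω - ω ^ α / α) = 0 := by
  have hdΦ : ∀ t > (0 : ℝ), HasDerivAt Φ (confDeriv α Φ t / t ^ (1 - α)) t := fun t ht =>
    ((hΦ.differentiableOn three_ne_zero).differentiableAt
      (Ioi_mem_nhds ht)).hasDerivAt_confDeriv ht
  have hdW : ∀ t > (0 : ℝ),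
      HasDerivAt W ((Φ t * (2 * W t - t ^ α / α) - γ) / t ^ (1 - α)) t := by
    intro t ht
    have hd2 := ((hΦ.of_le (by norm_num)).differentiableAt_confDeriv (α := α)
      ht).hasDerivAt_confDeriv (α := α) ht
    rw [hP2 t ht] at hd2
    have hW : W = fun x => -(confDeriv α Φ x) - (Φ x) ^ 2 := funext hWdef
    rw [hWdef t, hW]
    refine (hd2.neg.sub ((hdΦ t ht).pow 2)).congr_deriv ?_
    push_cast
    ring
  have hDW : ∀ t > (0 : ℝ), confDeriv α W t = Φ t * (2 * W t - t ^ α / α) - γ := by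
    intro t ht
    rw [(hdW t ht).confDeriv_eq, mul_div_cancel₀ _ (Real.rpow_pos_of_pos ht _).ne']
  intro ω hω hne
  have hc : ω ^ (1 - α) ≠ 0 := (Real.rpow_pos_of_pos hω _).ne'
  have hdDW := (((hdΦ ω hω).mul (((hdW ω hω).const_mul 2).sub
    (hasDerivAt_rpow_div_self hα.1.ne' hω))).sub_const γ).congr_of_eventuallyEq
      (f₁ := confDeriv α W) (by filter_upwards [Ioi_mem_nhds hω] with t ht using hDW t ht)
  have hD2W : confDeriv α (confDeriv α W) ω = confDeriv α Φ ω * (2 * W ω - ω ^ α / α)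
      + Φ ω * (2 * (Φ ω * (2 * W ω - ω ^ α / α) - γ) - 1) := by
    rw [hdDW.confDeriv_eq]
    simp only [Pi.sub_apply]
    field_simp
  have hDΦ : confDeriv α Φ ω = -W ω - (Φ ω) ^ 2 := by linarith [hWdef ω]
  have hu : 2 * W ω - ω ^ α / α ≠ 0 := sub_ne_zero.mpr hne
  rw [hD2W, hDW ω hω, hDΦ]
  obtain ⟨u, hz⟩ : ∃ u, ω ^ α / α = 2 * W ω - u := ⟨2 * W ω - ω ^ α / α, by ring⟩
  rw [hz, sub_sub_cancel] at hu ⊢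
  field_simp
  ring
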